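/- arXiv:2312.05400 — 7 statements merged into one kernel-verified Lean document; each statement's English description precedes it below -/
import Mathlib

section
/- Suppose consistency holds (Y₁ = A·Y₁(1) + (1−A)·Y₁(0) almost surely), and let g₁ be a version of E[Y₁(0) | W₀, A=1], μ₁ a version of E[Y₁ | W₀, A=0], g₀ a version of E[Y₀ | W₋₁, A=1], and μ₀ a version of E[Y₀ | W₋₁, A=0] satisfying the stable bias assumption. Then the ATT is identified by the generalized difference-in-differences functional: τ = E[Y₁ | A=1] − E[μ₁(W₀) | A=1] − ( E[Y₀ | A=1] − E[μ₀(W₋₁) | A=1] ). -/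
open MeasureTheory

/-- `f` is a version of the conditional expectation `E[Z | W, Ev]`:
it is measurable, `f ∘ W` is integrable, and for every measurable `S`,
`E[Z · 1_Ev · 1_{W ∈ S}] = E[f(W) · 1_Ev · 1_{W ∈ S}]`. -/
def IsCondexpVersion {Ω 𝒲 : Type*} [MeasurableSpace Ω] [MeasurableSpace 𝒲]
    (μ : Measure Ω) (Z : Ω → ℝ) (W : Ω → 𝒲) (Ev : Set Ω) (f : 𝒲 → ℝ) : Prop :=
  Measurable f ∧ Integrable (fun ω => f (W ω)) μ ∧
    ∀ S : Set 𝒲, MeasurableSet S →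
      ∫ ω in Ev ∩ W ⁻¹' S, Z ω ∂μ = ∫ ω in Ev ∩ W ⁻¹' S, f (W ω) ∂μ

/-- Conditional expectation given an event: `E[Z | E] = E[Z · 1_E] / P(E)`. -/
noncomputable def cE {Ω : Type*} [MeasurableSpace Ω]
    (μ : Measure Ω) (Z : Ω → ℝ) (E : Set Ω) : ℝ :=
  (∫ ω in E, Z ω ∂μ) / (μ E).toReal

/-- `cE` is additive under subtraction of integrable variables. -/
theorem cE_sub {Ω : Type*} [MeasurableSpace Ω] {μ : Measure Ω} {X Z : Ω → ℝ}
    (hX : Integrable X μ) (hZ : Integrable Z μ) (E : Set Ω) :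
    cE μ (fun ω => X ω - Z ω) E = cE μ X E - cE μ Z E := by
  simp only [cE, integral_sub hX.integrableOn hZ.integrableOn, sub_div]

/-- The tower property: a version of `E[Z | W, E]` has the same mean as `Z` given `E`. -/
theorem IsCondexpVersion.cE_eq {Ω 𝒲 : Type*} [MeasurableSpace Ω] [MeasurableSpace 𝒲]
    {μ : Measure Ω} {Z : Ω → ℝ} {W : Ω → 𝒲} {E : Set Ω} {f : 𝒲 → ℝ}
    (h : IsCondexpVersion μ Z W E f) : cE μ (fun ω => f (W ω)) E = cE μ Z E := by
  have := h.2.2 Set.univ MeasurableSet.univ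
  simp only [Set.preimage_univ, Set.inter_univ] at this
  simp only [cE, this]

/-- Identification of the ATT by the generalized difference-in-differences functional
under consistency and the stable bias assumption. -/
theorem gdid_identification
    {Ω 𝒲₀ 𝒲' : Type*} [MeasurableSpace Ω] [MeasurableSpace 𝒲₀] [MeasurableSpace 𝒲']
    (μ : Measure Ω) [IsProbabilityMeasure μ]
    (A Y1 Y0 Y1c1 Y1c0 : Ω → ℝ) (W0 : Ω → 𝒲₀) (Wm1 : Ω → 𝒲')
    (hA : Measurable A) (hAbin : ∀ ω, A ω = 0 ∨ A ω = 1)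
    (hW0 : Measurable W0) (hWm1 : Measurable Wm1)
    (hY1 : Integrable Y1 μ) (hY0 : Integrable Y0 μ)
    (hY1c1 : Integrable Y1c1 μ) (hY1c0 : Integrable Y1c0 μ)
    (hpos : 0 < μ {ω | A ω = 1}) (hlt : μ {ω | A ω = 1} < 1)
    (hconsistency : ∀ᵐ ω ∂μ, Y1 ω = A ω * Y1c1 ω + (1 - A ω) * Y1c0 ω)
    (g1 m1 : 𝒲₀ → ℝ) (g0 m0 : 𝒲' → ℝ)
    (hg1 : IsCondexpVersion μ Y1c0 W0 {ω | A ω = 1} g1)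
    (hm1 : IsCondexpVersion μ Y1 W0 {ω | A ω = 0} m1)
    (hg0 : IsCondexpVersion μ Y0 Wm1 {ω | A ω = 1} g0)
    (hm0 : IsCondexpVersion μ Y0 Wm1 {ω | A ω = 0} m0)
    (hstable : cE μ (fun ω => g1 (W0 ω) - m1 (W0 ω)) {ω | A ω = 1}
             = cE μ (fun ω => g0 (Wm1 ω) - m0 (Wm1 ω)) {ω | A ω = 1}) :
    cE μ (fun ω => Y1c1 ω - Y1c0 ω) {ω | A ω = 1}
      = cE μ Y1 {ω | A ω = 1} - cE μ (fun ω => m1 (W0 ω)) {ω | A ω = 1}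
        - (cE μ Y0 {ω | A ω = 1} - cE μ (fun ω => m0 (Wm1 ω)) {ω | A ω = 1}) := by
  have hY : cE μ Y1 {ω | A ω = 1} = cE μ Y1c1 {ω | A ω = 1} := by
    unfold cE
    congr 1
    refine setIntegral_congr_ae (hA (measurableSet_singleton 1)) ?_
    filter_upwards [hconsistency] with ω h hω
    have hω' : A ω = 1 := hω
    simp [h, hω']
  rw [cE_sub hg1.2.1 hm1.2.1, cE_sub hg0.2.1 hm0.2.1, hg1.cE_eq, hg0.cE_eq] at hstable
  rw [cE_sub hY1c1 hY1c0, hY]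
  linarith
end

section
/- Suppose consistency holds (Y₁ = A·Y₁(1) + (1−A)·Y₁(0) almost surely), π_X is a version of P(A=1 | X) satisfying positivity π_X(X) ≤ 1−ε almost surely for some ε > 0, Δ is a version of E[Y₁ − Y₀ | X, A=0], h is a version of E[Y₁(0) − Y₀ | X, A=1], and conditional parallel trends holds: h(X) = Δ(X) P-almost surely. Then the ATT is identified by the conditional difference-in-differences functional: τ = E[Y₁ − Y₀ | A=1] − E[Δ(X) | A=1]. -/
open MeasureTheory

/-- `p` is a version of the propensity score `P(A = 1 | W)`: it is measurable with
values in `[0,1]`, and `E[A · 1_{W ∈ S}] = E[p(W) · 1_{W ∈ S}]` for every measurable `S`. -/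
def IsPropensityVersion {Ω 𝒲 : Type*} [MeasurableSpace Ω] [MeasurableSpace 𝒲]
    (μ : Measure Ω) (A : Ω → ℝ) (W : Ω → 𝒲) (p : 𝒲 → ℝ) : Prop :=
  Measurable p ∧ (∀ w, p w ∈ Set.Icc (0 : ℝ) 1) ∧
    ∀ S : Set 𝒲, MeasurableSet S →
      ∫ ω in W ⁻¹' S, A ω ∂μ = ∫ ω in W ⁻¹' S, p (W ω) ∂μ

/-- Identification of the ATT by the conditional difference-in-differences functional
under consistency, positivity, and conditional parallel trends. -/
theorem cdid_identification
    {Ω 𝒳 : Type*} [MeasurableSpace Ω] [MeasurableSpace 𝒳]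
    (μ : Measure Ω) [IsProbabilityMeasure μ]
    (A Y1 Y0 Y1c1 Y1c0 : Ω → ℝ) (X : Ω → 𝒳)
    (hA : Measurable A) (hAbin : ∀ ω, A ω = 0 ∨ A ω = 1)
    (hX : Measurable X)
    (hY1 : Integrable Y1 μ) (hY0 : Integrable Y0 μ)
    (hY1c1 : Integrable Y1c1 μ) (hY1c0 : Integrable Y1c0 μ)
    (hpos : 0 < μ {ω | A ω = 1}) (hlt : μ {ω | A ω = 1} < 1)
    (hconsistency : ∀ᵐ ω ∂μ, Y1 ω = A ω * Y1c1 ω + (1 - A ω) * Y1c0 ω)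
    (πX : 𝒳 → ℝ) (hπX : IsPropensityVersion μ A X πX)
    (ε : ℝ) (hε : 0 < ε) (hπε : ∀ᵐ ω ∂μ, πX (X ω) ≤ 1 - ε)
    (Δ h : 𝒳 → ℝ)
    (hΔ : IsCondexpVersion μ (fun ω => Y1 ω - Y0 ω) X {ω | A ω = 0} Δ)
    (hh : IsCondexpVersion μ (fun ω => Y1c0 ω - Y0 ω) X {ω | A ω = 1} h)
    (hpt : ∀ᵐ ω ∂μ, h (X ω) = Δ (X ω)) :
    cE μ (fun ω => Y1c1 ω - Y1c0 ω) {ω | A ω = 1}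
      = cE μ (fun ω => Y1 ω - Y0 ω) {ω | A ω = 1}
        - cE μ (fun ω => Δ (X ω)) {ω | A ω = 1} := by
  have hE : MeasurableSet {ω | A ω = 1} := hA (measurableSet_singleton 1)
  have key : ∫ ω in {ω | A ω = 1}, (Y1c0 ω - Y0 ω) ∂μ = ∫ ω in {ω | A ω = 1}, Δ (X ω) ∂μ := by
    have hset := hh.2.2 Set.univ MeasurableSet.univ
    rw [Set.preimage_univ, Set.inter_univ] at hset
    exact hset.trans (integral_congr_ae (ae_restrict_of_ae hpt))
  have htreated : ∫ ω in {ω | A ω = 1}, Y1 ω ∂μ = ∫ ω in {ω | A ω = 1}, Y1c1 ω ∂μ := by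
    refine setIntegral_congr_ae hE ?_
    filter_upwards [hconsistency] with ω hω hω1
    rw [hω, show A ω = 1 from hω1]
    ring
  rw [integral_sub hY1c0.integrableOn hY0.integrableOn] at key
  unfold cE
  rw [integral_sub hY1c1.integrableOn hY1c0.integrableOn,
    integral_sub hY1.integrableOn hY0.integrableOn, htreated, ← key]
  ring
end

section
/- Take the conditioning sets at times 0 and −1 both equal to the time-invariant covariates X (i.e., W₀ = W₋₁ = X). Suppose consistency holds (Y₁ = A·Y₁(1) + (1−A)·Y₁(0) almost surely), π_X is a version of P(A=1 | X) with π_X(X) ≤ 1−ε almost surely for some ε > 0 (positivity), and conditional parallel trends holds: for some version h of E[Y₁(0) − Y₀ | X, A=1] and some version Δ of E[Y₁ − Y₀ | X, A=0], h(X) = Δ(X) P-almost surely. Then the stable bias assumption holds with conditioning set X: for all versions g₁ of E[Y₁(0) | X, A=1], μ₁ of E[Y₁ | X, A=0], g₀ of E[Y₀ | X, A=1], and μ₀ of E[Y₀ | X, A=0], one has E[g₁(X) − μ₁(X) | A=1] = E[g₀(X) − μ₀(X) | A=1]. -/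
open MeasureTheory

section Versions

variable {Ω 𝒲 : Type*} [MeasurableSpace Ω] [MeasurableSpace 𝒲] {μ : Measure Ω}
  {Z Z' : Ω → ℝ} {W : Ω → 𝒲} {Ev : Set Ω} {f g : 𝒲 → ℝ}

theorem IsCondexpVersion.setIntegral_eq (hf : IsCondexpVersion μ Z W Ev f) :
    ∫ ω in Ev, Z ω ∂μ = ∫ ω in Ev, f (W ω) ∂μ := by
  simpa using hf.2.2 Set.univ MeasurableSet.univ

theorem IsCondexpVersion.sub (hZ : Integrable Z μ) (hZ' : Integrable Z' μ)
    (hf : IsCondexpVersion μ Z W Ev f) (hg : IsCondexpVersion μ Z' W Ev g) :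
    IsCondexpVersion μ (fun ω => Z ω - Z' ω) W Ev (fun w => f w - g w) := by
  refine ⟨hf.1.sub hg.1, hf.2.1.sub hg.2.1, fun S hS => ?_⟩
  rw [integral_sub hZ.integrableOn hZ'.integrableOn,
    integral_sub hf.2.1.integrableOn hg.2.1.integrableOn, hf.2.2 S hS, hg.2.2 S hS]

/-- Versions of `E[Z | W, Ev]` are almost surely unique on `Ev`. -/
theorem IsCondexpVersion.ae_eq (hW : Measurable W)
    (hf : IsCondexpVersion μ Z W Ev f) (hg : IsCondexpVersion μ Z W Ev g) :
    ∀ᵐ ω ∂μ.restrict Ev, f (W ω) = g (W ω) := by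
  have key : f =ᵐ[(μ.restrict Ev).map W] g := by
    refine Integrable.ae_eq_of_forall_setIntegral_eq f g ?_ ?_ fun S hS _ => ?_
    · exact (integrable_map_measure hf.1.aestronglyMeasurable hW.aemeasurable).2
        hf.2.1.integrableOn
    · exact (integrable_map_measure hg.1.aestronglyMeasurable hW.aemeasurable).2
        hg.2.1.integrableOn
    · rw [setIntegral_map hS hf.1.aestronglyMeasurable hW.aemeasurable,
        setIntegral_map hS hg.1.aestronglyMeasurable hW.aemeasurable,
        Measure.restrict_restrict (hW hS), Set.inter_comm, ← hf.2.2 S hS, ← hg.2.2 S hS]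
  exact ae_of_ae_map hW.aemeasurable key

end Versions

/-- Under positivity, a covariate set that almost surely contains no untreated units is null. -/
theorem IsPropensityVersion.measure_preimage_eq_zero {Ω 𝒲 : Type*} [MeasurableSpace Ω]
    [MeasurableSpace 𝒲] {μ : Measure Ω} [IsFiniteMeasure μ] {A : Ω → ℝ} {W : Ω → 𝒲}
    {p : 𝒲 → ℝ} (hp : IsPropensityVersion μ A W p) (hW : Measurable W)
    {ε : ℝ} (hε : 0 < ε) (hpε : ∀ᵐ ω ∂μ, p (W ω) ≤ 1 - ε)
    {T : Set 𝒲} (hT : MeasurableSet T) (hAT : ∀ᵐ ω ∂μ, W ω ∈ T → A ω = 1) :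
    μ (W ⁻¹' T) = 0 := by
  have hA : ∫ ω in W ⁻¹' T, A ω ∂μ = μ.real (W ⁻¹' T) := by
    rw [setIntegral_congr_ae (g := fun _ => (1 : ℝ)) (hW hT) hAT]
    simp
  have hint : Integrable (fun ω => p (W ω)) μ :=
    Integrable.of_bound (hp.1.comp hW).aestronglyMeasurable 1
      (Filter.Eventually.of_forall fun ω => by
        rw [Real.norm_eq_abs, abs_of_nonneg (hp.2.1 _).1]
        exact (hp.2.1 _).2)
  have hle : ∫ ω in W ⁻¹' T, p (W ω) ∂μ ≤ ∫ _ in W ⁻¹' T, (1 - ε) ∂μ :=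
    setIntegral_mono_ae hint.integrableOn (integrable_const _).integrableOn hpε
  rw [← hp.2.2 T hT, hA, setIntegral_const, smul_eq_mul] at hle
  refine (measureReal_eq_zero_iff).1 (le_antisymm ?_ measureReal_nonneg)
  nlinarith

/-- With conditioning sets at times 0 and −1 both equal to the time-invariant covariates `X`,
consistency, positivity and conditional parallel trends imply the stable bias assumption
with conditioning set `X`. -/
theorem parallel_trends_implies_stable_bias
    {Ω 𝒳 : Type*} [MeasurableSpace Ω] [MeasurableSpace 𝒳]
    (μ : Measure Ω) [IsProbabilityMeasure μ]
    (A Y1 Y0 Y1c1 Y1c0 : Ω → ℝ) (X : Ω → 𝒳)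
    (hA : Measurable A) (hAbin : ∀ ω, A ω = 0 ∨ A ω = 1)
    (hX : Measurable X)
    (hY1 : Integrable Y1 μ) (hY0 : Integrable Y0 μ)
    (hY1c1 : Integrable Y1c1 μ) (hY1c0 : Integrable Y1c0 μ)
    (hpos : 0 < μ {ω | A ω = 1}) (hlt : μ {ω | A ω = 1} < 1)
    (hconsistency : ∀ᵐ ω ∂μ, Y1 ω = A ω * Y1c1 ω + (1 - A ω) * Y1c0 ω)
    (πX : 𝒳 → ℝ) (hπX : IsPropensityVersion μ A X πX)
    (ε : ℝ) (hε : 0 < ε) (hπε : ∀ᵐ ω ∂μ, πX (X ω) ≤ 1 - ε)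
    (Δ h : 𝒳 → ℝ)
    (hh : IsCondexpVersion μ (fun ω => Y1c0 ω - Y0 ω) X {ω | A ω = 1} h)
    (hΔ : IsCondexpVersion μ (fun ω => Y1 ω - Y0 ω) X {ω | A ω = 0} Δ)
    (hpt : ∀ᵐ ω ∂μ, h (X ω) = Δ (X ω)) :
    ∀ (g1 m1 g0 m0 : 𝒳 → ℝ),
      IsCondexpVersion μ Y1c0 X {ω | A ω = 1} g1 →
      IsCondexpVersion μ Y1 X {ω | A ω = 0} m1 →
      IsCondexpVersion μ Y0 X {ω | A ω = 1} g0 →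
      IsCondexpVersion μ Y0 X {ω | A ω = 0} m0 →
      cE μ (fun ω => g1 (X ω) - m1 (X ω)) {ω | A ω = 1}
        = cE μ (fun ω => g0 (X ω) - m0 (X ω)) {ω | A ω = 1} := by
  intro g1 m1 g0 m0 hg1 hm1 hg0 hm0
  have hA0 : MeasurableSet {ω | A ω = 0} := hA (measurableSet_singleton 0)
  have hm := hm1.sub hY1 hY0 hm0
  have hT : MeasurableSet {x | Δ x ≠ m1 x - m0 x} :=
    (measurableSet_eq_fun hΔ.1 hm.1).compl
  have hnull := hπX.measure_preimage_eq_zero hX hε hπε hT (by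
    filter_upwards [(ae_restrict_iff' hA0).1 (hΔ.ae_eq hX hm)] with ω hω hne
    exact (hAbin ω).resolve_left fun h0 => hne (hω h0))
  have hΔm : ∀ᵐ ω ∂μ, Δ (X ω) = m1 (X ω) - m0 (X ω) := hnull
  have hg : ∫ ω in {ω | A ω = 1}, (g1 (X ω) - g0 (X ω)) ∂μ
      = ∫ ω in {ω | A ω = 1}, (m1 (X ω) - m0 (X ω)) ∂μ := by
    rw [← (hg1.sub hY1c0 hY0 hg0).setIntegral_eq, hh.setIntegral_eq]
    refine integral_congr_ae (ae_restrict_of_ae ?_)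
    filter_upwards [hpt, hΔm] with ω h1 h2
    rw [h1, h2]
  unfold cE
  congr 1
  rw [integral_sub hg1.2.1.integrableOn hg0.2.1.integrableOn,
    integral_sub hm1.2.1.integrableOn hm0.2.1.integrableOn] at hg
  rw [integral_sub hg1.2.1.integrableOn hm1.2.1.integrableOn,
    integral_sub hg0.2.1.integrableOn hm0.2.1.integrableOn]
  linarith
end

section
/- Suppose Δ is a version of E[Y₁ − Y₀ | X, A=0], h is a version of E[Y₁(0) − Y₀ | X, A=1], and conditional parallel trends holds: h(X) = Δ(X) P-almost surely. Then the mean counterfactual outcome of the treated under no treatment satisfies the imputation identity E[Y₁(0) | A=1] = E[Y₀ + Δ(X) | A=1]; that is, the difference-in-differences imputation function η^cDiD(W) = Y₀ + Δ(X) correctly imputes E[Y₁(0) | A=1]. -/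
open MeasureTheory

/-- Under conditional parallel trends, the difference-in-differences imputation function
`η^cDiD = Y₀ + Δ(X)` correctly imputes the mean counterfactual outcome of the treated:
`E[Y₁(0) | A=1] = E[Y₀ + Δ(X) | A=1]`. -/
theorem cdid_imputation
    {Ω 𝒳 : Type*} [MeasurableSpace Ω] [MeasurableSpace 𝒳]
    (μ : Measure Ω) [IsProbabilityMeasure μ]
    (A Y1 Y0 Y1c0 : Ω → ℝ) (X : Ω → 𝒳)
    (hA : Measurable A) (hAbin : ∀ ω, A ω = 0 ∨ A ω = 1)
    (hX : Measurable X)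
    (hY1 : Integrable Y1 μ) (hY0 : Integrable Y0 μ) (hY1c0 : Integrable Y1c0 μ)
    (hpos : 0 < μ {ω | A ω = 1}) (hlt : μ {ω | A ω = 1} < 1)
    (hconsistency : ∀ᵐ ω ∂μ, A ω = 0 → Y1 ω = Y1c0 ω)
    (Δ h : 𝒳 → ℝ)
    (hΔ : IsCondexpVersion μ (fun ω => Y1 ω - Y0 ω) X {ω | A ω = 0} Δ)
    (hh : IsCondexpVersion μ (fun ω => Y1c0 ω - Y0 ω) X {ω | A ω = 1} h)
    (hpt : ∀ᵐ ω ∂μ, h (X ω) = Δ (X ω)) :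
    cE μ Y1c0 {ω | A ω = 1}
      = cE μ (fun ω => Y0 ω + Δ (X ω)) {ω | A ω = 1} := by
  obtain ⟨-, -, hh⟩ := hh
  have key : ∫ ω in {ω | A ω = 1}, (Y1c0 ω - Y0 ω) ∂μ
      = ∫ ω in {ω | A ω = 1}, h (X ω) ∂μ := by
    simpa using hh Set.univ MeasurableSet.univ
  have hΔh : ∫ ω in {ω | A ω = 1}, h (X ω) ∂μ = ∫ ω in {ω | A ω = 1}, Δ (X ω) ∂μ :=
    integral_congr_ae (ae_restrict_of_ae hpt)
  rw [integral_sub hY1c0.integrableOn hY0.integrableOn, hΔh] at key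
  unfold cE
  rw [integral_add hY0.integrableOn hΔ.2.1.integrableOn, ← key, add_sub_cancel]
end

section
/- Let π be a version of P(A=1 | W₀) and π₀ a version of P(A=1 | W₋₁), each bounded above by 1−ε almost surely for some ε > 0 (positivity); let μ₁ be a version of E[Y₁ | W₀, A=0] and μ₀ a version of E[Y₀ | W₋₁, A=0], with μ₁(W₀) and μ₀(W₋₁) integrable. Define the observed-data functional τ^gDiD = E[Y₁ | A=1] − E[μ₁(W₀) | A=1] − E[Y₀ | A=1] + E[μ₀(W₋₁) | A=1]. Then the generalized difference-in-differences influence function φ(O) = P(A=1)^{-1}·[ A·Y₁ − ((1−A)π(W₀)Y₁ + (A−π(W₀))μ₁(W₀))/(1−π(W₀)) − A·Y₀ + ((1−A)π₀(W₋₁)Y₀ + (A−π₀(W₋₁))μ₀(W₋₁))/(1−π₀(W₋₁)) ] − τ^gDiD has mean zero: E[φ(O)] = 0. -/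
open MeasureTheory

/-- If the integral of `f` vanishes over every `W`-measurable event, then so does the integral of
`g ∘ W * f` for every bounded `W`-measurable weight. -/
lemma integral_comp_mul_eq_zero_of_setIntegral_preimage_eq_zero
    {Ω 𝒲 : Type*} [MeasurableSpace Ω] [MeasurableSpace 𝒲]
    {ν : Measure Ω} [IsFiniteMeasure ν] {W : Ω → 𝒲} (hW : Measurable W)
    {f : Ω → ℝ} (hf : Integrable f ν)
    (hzero : ∀ S : Set 𝒲, MeasurableSet S → ∫ ω in W ⁻¹' S, f ω ∂ν = 0)
    {g : 𝒲 → ℝ} (hg : Measurable g) (hgf : Integrable (fun ω => g (W ω) * f ω) ν) :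
    ∫ ω, g (W ω) * f ω ∂ν = 0 := by
  have hm := hW.comap_le
  have hcond : (0 : Ω → ℝ) =ᵐ[ν] ν[f | MeasurableSpace.comap W inferInstance] := by
    refine ae_eq_condExp_of_forall_setIntegral_eq hm hf (fun _ _ _ => integrableOn_zero) ?_
      stronglyMeasurable_zero.aestronglyMeasurable
    rintro _ ⟨S, hS, rfl⟩ -
    simp [hzero S hS]
  have hgm : StronglyMeasurable[MeasurableSpace.comap W inferInstance] (fun ω => g (W ω)) :=
    (hg.comp (comap_measurable W)).stronglyMeasurable
  have hpull := condExp_mul_of_stronglyMeasurable_left hgm hgf hf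
  rw [← integral_condExp hm, ← integral_zero Ω ℝ (μ := ν)]
  refine integral_congr_ae ?_
  filter_upwards [hpull, hcond] with ω h1 h2
  exact h1.trans (by simp [← h2])

/-- The augmented inverse-probability-weighted term of the influence function is integrable and
its mean is that of the outcome regression over the treated. -/
lemma IsCondexpVersion.integrable_and_integral_augmented_eq
    {Ω 𝒲 : Type*} [MeasurableSpace Ω] [MeasurableSpace 𝒲]
    {μ : Measure Ω} [IsProbabilityMeasure μ] {A Y : Ω → ℝ} {W : Ω → 𝒲}
    (hA : Measurable A) (hAbin : ∀ ω, A ω = 0 ∨ A ω = 1) (hW : Measurable W)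
    (hY : Integrable Y μ) {p : 𝒲 → ℝ} (hp : Measurable p) (hp01 : ∀ w, p w ∈ Set.Icc (0 : ℝ) 1)
    {ε : ℝ} (hε : 0 < ε) (hpε : ∀ᵐ ω ∂μ, p (W ω) ≤ 1 - ε)
    {m : 𝒲 → ℝ} (hm : IsCondexpVersion μ Y W {ω | A ω = 0} m) :
    Integrable (fun ω => ((1 - A ω) * p (W ω) * Y ω + (A ω - p (W ω)) * m (W ω))
        / (1 - p (W ω))) μ ∧
      ∫ ω, ((1 - A ω) * p (W ω) * Y ω + (A ω - p (W ω)) * m (W ω)) / (1 - p (W ω)) ∂μ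
        = ∫ ω in {ω | A ω = 1}, m (W ω) ∂μ := by
  obtain ⟨-, hmi, hmS⟩ := hm
  have h0 : MeasurableSet {ω | A ω = 0} := hA (measurableSet_singleton 0)
  have h1 : MeasurableSet {ω | A ω = 1} := hA (measurableSet_singleton 1)
  have hodds : Measurable (fun w => p w / (1 - p w)) := hp.div (measurable_const.sub hp)
  have hd : Integrable (fun ω => Y ω - m (W ω)) μ := hY.sub hmi
  have hgd : Integrable (fun ω => p (W ω) / (1 - p (W ω)) * (Y ω - m (W ω))) μ := by
    refine hd.bdd_mul (c := 1 / ε) (hodds.comp hW).aestronglyMeasurable ?_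
    filter_upwards [hpε] with ω hω
    have hpos : 0 < 1 - p (W ω) := by linarith
    rw [Real.norm_of_nonneg (div_nonneg (hp01 _).1 hpos.le)]
    exact div_le_div₀ zero_le_one (hp01 _).2 hε (by linarith)
  have hres : ∫ ω in {ω | A ω = 0}, p (W ω) / (1 - p (W ω)) * (Y ω - m (W ω)) ∂μ = 0 := by
    refine integral_comp_mul_eq_zero_of_setIntegral_preimage_eq_zero hW hd.integrableOn
      (fun S hS => ?_) hodds hgd.integrableOn
    rw [Measure.restrict_restrict (hW hS), Set.inter_comm,
      integral_sub hY.integrableOn hmi.integrableOn, hmS S hS, sub_self]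
  have hdecomp : (fun ω => ((1 - A ω) * p (W ω) * Y ω + (A ω - p (W ω)) * m (W ω))
      / (1 - p (W ω))) =ᵐ[μ] fun ω => {ω | A ω = 1}.indicator (fun ω => m (W ω)) ω
        + {ω | A ω = 0}.indicator
            (fun ω => p (W ω) / (1 - p (W ω)) * (Y ω - m (W ω))) ω := by
    filter_upwards [hpε] with ω hω
    have hne : 1 - p (W ω) ≠ 0 := by linarith
    rcases hAbin ω with h | h
    · simp only [Set.indicator, Set.mem_ofPred_eq, h, zero_ne_one, if_true, if_false]
      field_simp
      ring
    · simp only [Set.indicator, Set.mem_ofPred_eq, h, one_ne_zero, if_true, if_false]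
      field_simp
      ring
  have hi1 := hmi.indicator h1
  have hi0 := hgd.indicator h0
  refine ⟨(hi1.add hi0).congr hdecomp.symm, ?_⟩
  rw [integral_congr_ae hdecomp, integral_add hi1 hi0, integral_indicator h1,
    integral_indicator h0, hres, add_zero]

/-- Multiplying by a binary variable restricts to the event that it equals one. -/
lemma integrable_and_integral_binary_mul
    {Ω : Type*} [MeasurableSpace Ω] {μ : Measure Ω} {A Z : Ω → ℝ}
    (hA : Measurable A) (hAbin : ∀ ω, A ω = 0 ∨ A ω = 1) (hZ : Integrable Z μ) :
    Integrable (fun ω => A ω * Z ω) μ ∧ ∫ ω, A ω * Z ω ∂μ = ∫ ω in {ω | A ω = 1}, Z ω ∂μ := by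
  have h1 : MeasurableSet {ω | A ω = 1} := hA (measurableSet_singleton 1)
  have heq : (fun ω => A ω * Z ω) = {ω | A ω = 1}.indicator Z := by
    funext ω
    rcases hAbin ω with h | h <;> simp [Set.indicator, h]
  rw [heq]
  exact ⟨hZ.indicator h1, integral_indicator h1⟩

/-- The generalized difference-in-differences influence function has mean zero:
`E[φ(O)] = 0`, where `φ` is the influence function of the observed-data functional
`τ^gDiD = E[Y₁ | A=1] − E[μ₁(W₀) | A=1] − E[Y₀ | A=1] + E[μ₀(W₋₁) | A=1]`. -/
theorem gdid_influence_function_mean_zero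
    {Ω 𝒲₀ 𝒲' : Type*} [MeasurableSpace Ω] [MeasurableSpace 𝒲₀] [MeasurableSpace 𝒲']
    (μ : Measure Ω) [IsProbabilityMeasure μ]
    (A Y1 Y0 : Ω → ℝ) (W0 : Ω → 𝒲₀) (Wm1 : Ω → 𝒲')
    (hA : Measurable A) (hAbin : ∀ ω, A ω = 0 ∨ A ω = 1)
    (hW0 : Measurable W0) (hWm1 : Measurable Wm1)
    (hY1 : Integrable Y1 μ) (hY0 : Integrable Y0 μ)
    (hpos : 0 < μ {ω | A ω = 1}) (hlt : μ {ω | A ω = 1} < 1)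
    (π : 𝒲₀ → ℝ) (hπ : IsPropensityVersion μ A W0 π)
    (π0 : 𝒲' → ℝ) (hπ0 : IsPropensityVersion μ A Wm1 π0)
    (ε : ℝ) (hε : 0 < ε)
    (hπε : ∀ᵐ ω ∂μ, π (W0 ω) ≤ 1 - ε) (hπ0ε : ∀ᵐ ω ∂μ, π0 (Wm1 ω) ≤ 1 - ε)
    (m1 : 𝒲₀ → ℝ) (hm1 : IsCondexpVersion μ Y1 W0 {ω | A ω = 0} m1)
    (m0 : 𝒲' → ℝ) (hm0 : IsCondexpVersion μ Y0 Wm1 {ω | A ω = 0} m0)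
    (τ : ℝ)
    (hτ : τ = cE μ Y1 {ω | A ω = 1} - cE μ (fun ω => m1 (W0 ω)) {ω | A ω = 1}
            - cE μ Y0 {ω | A ω = 1} + cE μ (fun ω => m0 (Wm1 ω)) {ω | A ω = 1})
    (φ : Ω → ℝ)
    (hφ : ∀ ω, φ ω = (μ {ω' | A ω' = 1}).toReal⁻¹
        * (A ω * Y1 ω
          - ((1 - A ω) * π (W0 ω) * Y1 ω + (A ω - π (W0 ω)) * m1 (W0 ω))
              / (1 - π (W0 ω))
          - A ω * Y0 ω
          + ((1 - A ω) * π0 (Wm1 ω) * Y0 ω + (A ω - π0 (Wm1 ω)) * m0 (Wm1 ω))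
              / (1 - π0 (Wm1 ω)))
        - τ) :
    ∫ ω, φ ω ∂μ = 0 := by
  obtain ⟨iY1, eY1⟩ := integrable_and_integral_binary_mul hA hAbin hY1
  obtain ⟨iY0, eY0⟩ := integrable_and_integral_binary_mul hA hAbin hY0
  obtain ⟨i1, e1⟩ :=
    hm1.integrable_and_integral_augmented_eq hA hAbin hW0 hY1 hπ.1 hπ.2.1 hε hπε
  obtain ⟨i0, e0⟩ :=
    hm0.integrable_and_integral_augmented_eq hA hAbin hWm1 hY0 hπ0.1 hπ0.2.1 hε hπ0ε
  have j1 := iY1.sub' i1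
  have j2 := j1.sub' iY0
  have j3 := j2.fun_add i0
  simp_rw [hφ]
  rw [integral_sub (j3.const_mul _) (integrable_const τ), integral_const_mul,
    integral_add j2 i0, integral_sub j1 iY0, integral_sub iY1 i1, eY1, eY0, e1, e0, hτ]
  simp only [integral_const, probReal_univ, one_smul, cE]
  ring
end

section
/- (Neyman orthogonality of the ignorability moment function.) Let π be a version of P(A=1 | W₀) with π(W₀) ≤ 1−ε almost surely for some ε ∈ (0,1), and let μ₁ be a bounded measurable version of E[Y₁ | W₀, A=0]; set τ^ign = E[Y₁ | A=1] − E[μ₁(W₀) | A=1]. Let π̃ : 𝒲₀ → [0, 1−ε] be measurable and μ̃ : 𝒲₀ → ℝ be bounded measurable. For |r| < ε/2 define π_r = π + r(π̃ − π), μ_r = μ₁ + r(μ̃ − μ₁), and F(r) = E[ A·Y₁ − ((1−A)·π_r(W₀)·Y₁ + (A − π_r(W₀))·μ_r(W₀)) / (1 − π_r(W₀)) ] − P(A=1)·τ^ign. Then F(0) = 0 and F is differentiable at r = 0 with F′(0) = 0. -/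
open MeasureTheory

/-- If `g` has vanishing integral over every event `W ∈ S`, then it is orthogonal to every
function of `W`. -/
theorem integral_mul_comp_eq_zero {Ω 𝒲 : Type*} [MeasurableSpace Ω] [MeasurableSpace 𝒲]
    {μ : Measure Ω} [IsFiniteMeasure μ] {g : Ω → ℝ} {W : Ω → 𝒲} {h : 𝒲 → ℝ}
    (hW : Measurable W) (hg : Integrable g μ)
    (hg0 : ∀ S : Set 𝒲, MeasurableSet S → ∫ ω in W ⁻¹' S, g ω ∂μ = 0)
    (hh : Measurable h) (hgh : Integrable (fun ω => g ω * h (W ω)) μ) :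
    ∫ ω, g ω * h (W ω) ∂μ = 0 := by
  have hm := hW.comap_le
  have hcond : (0 : Ω → ℝ) =ᵐ[μ] μ[g | MeasurableSpace.comap W inferInstance] := by
    refine ae_eq_condExp_of_forall_setIntegral_eq hm hg
      (fun _ _ _ => (integrable_zero _ _ _).integrableOn) ?_
      (stronglyMeasurable_zero.aestronglyMeasurable)
    rintro _ ⟨S, hS, rfl⟩ -
    simp [hg0 S hS]
  have hhW : StronglyMeasurable[MeasurableSpace.comap W inferInstance] (fun ω => h (W ω)) :=
    (hh.comp (comap_measurable W)).stronglyMeasurable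
  have hmul := condExp_mul_of_stronglyMeasurable_right (f := g) hhW hgh hg
  rw [← integral_condExp hm, ← integral_zero Ω ℝ (μ := μ)]
  refine integral_congr_ae ?_
  filter_upwards [hcond, hmul] with ω h₁ h₂
  refine h₂.trans ?_
  simp [← h₁]

/-- A function bounded by `C * r ^ 2` near `0` vanishes at `0` together with its derivative. -/
theorem hasDerivAt_zero_of_abs_le_mul_sq {F : ℝ → ℝ} {C δ : ℝ} (hδ : 0 < δ)
    (h : ∀ r, |r| < δ → |F r| ≤ C * r ^ 2) : F 0 = 0 ∧ HasDerivAt F 0 0 := by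
  have h0 : F 0 = 0 := by simpa using h 0 (by simpa using hδ)
  refine ⟨h0, ?_⟩
  rw [hasDerivAt_iff_isLittleO]
  have hO : F =O[nhds 0] fun r : ℝ => r ^ 2 := by
    refine Asymptotics.IsBigO.of_bound C ?_
    filter_upwards [Metric.ball_mem_nhds (0 : ℝ) hδ] with r hr
    simpa using h r (by simpa using hr)
  simpa [h0] using hO.trans_isLittleO (Asymptotics.isLittleO_pow_id one_lt_two)

/-- Neyman orthogonality of the ignorability moment function: with the nuisance functions
linearly perturbed as `π_r = π + r(π̃ − π)` and `μ_r = μ₁ + r(μ̃ − μ₁)`, the map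
`F(r) = E[A·Y₁ − ((1−A)π_r(W₀)Y₁ + (A − π_r(W₀))μ_r(W₀))/(1 − π_r(W₀))] − P(A=1)·τ^ign`
satisfies `F(0) = 0` and `F′(0) = 0`. -/
theorem neyman_orthogonality_ignorability
    {Ω 𝒲₀ : Type*} [MeasurableSpace Ω] [MeasurableSpace 𝒲₀]
    (μ : Measure Ω) [IsProbabilityMeasure μ]
    (A Y1 : Ω → ℝ) (W0 : Ω → 𝒲₀)
    (hA : Measurable A) (hAbin : ∀ ω, A ω = 0 ∨ A ω = 1)
    (hW0 : Measurable W0) (hY1 : Integrable Y1 μ)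
    (hpos : 0 < μ {ω | A ω = 1}) (hlt : μ {ω | A ω = 1} < 1)
    (ε : ℝ) (hε : 0 < ε) (hε1 : ε < 1)
    (π : 𝒲₀ → ℝ) (hπ : IsPropensityVersion μ A W0 π)
    (hπε : ∀ᵐ ω ∂μ, π (W0 ω) ≤ 1 - ε)
    (m1 : 𝒲₀ → ℝ) (hm1 : IsCondexpVersion μ Y1 W0 {ω | A ω = 0} m1)
    (C₁ : ℝ) (hm1bd : ∀ w, |m1 w| ≤ C₁)
    (πt : 𝒲₀ → ℝ) (hπt : Measurable πt)
    (hπtmem : ∀ w, πt w ∈ Set.Icc (0 : ℝ) (1 - ε))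
    (mt : 𝒲₀ → ℝ) (hmt : Measurable mt) (C₂ : ℝ) (hmtbd : ∀ w, |mt w| ≤ C₂)
    (τ : ℝ)
    (hτ : τ = cE μ Y1 {ω | A ω = 1} - cE μ (fun ω => m1 (W0 ω)) {ω | A ω = 1})
    (F : ℝ → ℝ)
    (hF : ∀ r : ℝ, |r| < ε / 2 →
      F r = (∫ ω, (A ω * Y1 ω
          - ((1 - A ω) * (π (W0 ω) + r * (πt (W0 ω) - π (W0 ω))) * Y1 ω
              + (A ω - (π (W0 ω) + r * (πt (W0 ω) - π (W0 ω))))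
                * (m1 (W0 ω) + r * (mt (W0 ω) - m1 (W0 ω))))
            / (1 - (π (W0 ω) + r * (πt (W0 ω) - π (W0 ω))))) ∂μ)
        - (μ {ω | A ω = 1}).toReal * τ) :
    F 0 = 0 ∧ HasDerivAt F 0 0 := by
  obtain ⟨hπm, hπ01, hπS⟩ := hπ
  obtain ⟨hm1m, hm1i, hm1S⟩ := hm1
  have hA1 : MeasurableSet {ω | A ω = 1} := hA (measurableSet_singleton 1)
  have hA0 : MeasurableSet {ω | A ω = 0} := hA (measurableSet_singleton 0)
  have hAi : Integrable A μ := by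
    refine Integrable.of_bound hA.aestronglyMeasurable 1 (.of_forall fun ω => ?_)
    rcases hAbin ω with h | h <;> simp [h]
  have hπi : Integrable (fun ω => π (W0 ω)) μ := by
    refine Integrable.of_bound (hπm.comp hW0).aestronglyMeasurable 1 (.of_forall fun ω => ?_)
    rw [Real.norm_eq_abs, abs_le]
    constructor <;> linarith [(hπ01 (W0 ω)).1, (hπ01 (W0 ω)).2]
  have hdi : Integrable (fun ω => Y1 ω - m1 (W0 ω)) μ := hY1.sub hm1i
  set g₁ : Ω → ℝ := {ω | A ω = 0}.indicator fun ω => Y1 ω - m1 (W0 ω) with hg₁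
  have hg₁i : Integrable g₁ μ := hdi.indicator hA0
  have hg₁S : ∀ S : Set 𝒲₀, MeasurableSet S → ∫ ω in W0 ⁻¹' S, g₁ ω ∂μ = 0 := by
    intro S hS
    rw [hg₁, setIntegral_indicator hA0, Set.inter_comm,
      integral_sub hY1.integrableOn hm1i.integrableOn, hm1S S hS, sub_self]
  have hg₂i : Integrable (fun ω => A ω - π (W0 ω)) μ := hAi.sub hπi
  have hg₂S : ∀ S : Set 𝒲₀, MeasurableSet S →
      ∫ ω in W0 ⁻¹' S, (A ω - π (W0 ω)) ∂μ = 0 := by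
    intro S hS
    rw [integral_sub hAi.integrableOn hπi.integrableOn, hπS S hS, sub_self]
  have hτ' : (μ {ω | A ω = 1}).toReal * τ = ∫ ω, (Y1 ω - m1 (W0 ω)) ∂μ := by
    have hne : (μ {ω | A ω = 1}).toReal ≠ 0 :=
      (ENNReal.toReal_pos hpos.ne' (measure_ne_top _ _)).ne'
    have hcompl : {ω | A ω = 1}ᶜ = {ω | A ω = 0} := by
      ext ω
      rcases hAbin ω with h | h <;> simp [h]
    have h0 : ∫ ω in {ω | A ω = 0}, (Y1 ω - m1 (W0 ω)) ∂μ = 0 := by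
      simpa [hg₁, integral_indicator hA0] using hg₁S Set.univ MeasurableSet.univ
    rw [← integral_add_compl hA1 hdi, hcompl, h0, add_zero,
      integral_sub hY1.integrableOn hm1i.integrableOn, hτ, cE, cE]
    field_simp
  refine hasDerivAt_zero_of_abs_le_mul_sq (C := (C₂ + C₁) * (2 / ε)) (half_pos hε) fun r hr => ?_
  set k : 𝒲₀ → ℝ := fun w => (1 - (π w + r * (πt w - π w)))⁻¹ with hk
  have hkm : Measurable k := by fun_prop
  have hd1 : ∀ w, |πt w - π w| ≤ 1 := fun w => by
    rw [abs_le]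
    constructor <;> linarith [(hπ01 w).1, (hπ01 w).2, (hπtmem w).1, (hπtmem w).2]
  have hδ : ∀ w, |mt w - m1 w| ≤ C₂ + C₁ := fun w =>
    (abs_sub _ _).trans (add_le_add (hmtbd w) (hm1bd w))
  have hden : ∀ᵐ ω ∂μ, ε / 2 ≤ 1 - (π (W0 ω) + r * (πt (W0 ω) - π (W0 ω))) := by
    filter_upwards [hπε] with ω hω
    have h1 : |r * (πt (W0 ω) - π (W0 ω))| ≤ ε / 2 := by
      rw [abs_mul]
      nlinarith [hd1 (W0 ω), abs_nonneg r, abs_nonneg (πt (W0 ω) - π (W0 ω))]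
    linarith [(abs_le.1 h1).2]
  have hkb : ∀ᵐ ω ∂μ, |k (W0 ω)| ≤ 2 / ε := by
    filter_upwards [hden] with ω hω
    rw [hk, abs_inv, abs_of_pos ((half_pos hε).trans_le hω), ← inv_div]
    exact inv_anti₀ (half_pos hε) hω
  have hδkb : ∀ᵐ ω ∂μ, |(mt (W0 ω) - m1 (W0 ω)) * k (W0 ω)| ≤ (C₂ + C₁) * (2 / ε) := by
    filter_upwards [hkb] with ω hω
    rw [abs_mul]
    exact mul_le_mul (hδ _) hω (abs_nonneg _) ((abs_nonneg _).trans (hδ (W0 ω)))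
  have hRb : ∀ᵐ ω ∂μ, ‖(mt (W0 ω) - m1 (W0 ω)) * k (W0 ω) * (πt (W0 ω) - π (W0 ω))‖
      ≤ (C₂ + C₁) * (2 / ε) := by
    filter_upwards [hδkb] with ω hω
    rw [Real.norm_eq_abs, abs_mul]
    exact (mul_le_of_le_one_right (abs_nonneg _) (hd1 _)).trans hω
  have hδkm : Measurable fun w => (mt w - m1 w) * k w := (hmt.sub hm1m).mul hkm
  have hRi : Integrable
      (fun ω => (mt (W0 ω) - m1 (W0 ω)) * k (W0 ω) * (πt (W0 ω) - π (W0 ω))) μ :=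
    Integrable.of_bound
      ((hδkm.mul (hπt.sub hπm)).comp hW0).aestronglyMeasurable _ hRb
  have hI₁ : Integrable (fun ω => g₁ ω * k (W0 ω)) μ :=
    hg₁i.mul_bdd (hkm.comp hW0).aestronglyMeasurable hkb
  have hI₂ : Integrable
      (fun ω => (A ω - π (W0 ω)) * ((mt (W0 ω) - m1 (W0 ω)) * k (W0 ω))) μ :=
    hg₂i.mul_bdd (hδkm.comp hW0).aestronglyMeasurable hδkb
  have hz₁ := integral_mul_comp_eq_zero hW0 hg₁i hg₁S hkm hI₁
  have hz₂ := integral_mul_comp_eq_zero hW0 hg₂i hg₂S hδkm hI₂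
  have hFr : F r = r ^ 2 *
      ∫ ω, (mt (W0 ω) - m1 (W0 ω)) * k (W0 ω) * (πt (W0 ω) - π (W0 ω)) ∂μ := by
    rw [hF r hr, hτ', sub_eq_iff_eq_add]
    calc
      _ = ∫ ω, ((Y1 ω - m1 (W0 ω)) - g₁ ω * k (W0 ω)
            - r * ((A ω - π (W0 ω)) * ((mt (W0 ω) - m1 (W0 ω)) * k (W0 ω)))
            + r ^ 2 * ((mt (W0 ω) - m1 (W0 ω)) * k (W0 ω) * (πt (W0 ω) - π (W0 ω)))) ∂μ := by
        refine integral_congr_ae ?_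
        filter_upwards [hden] with ω hω
        have hne := ((half_pos hε).trans_le hω).ne'
        have hg : g₁ ω = (1 - A ω) * (Y1 ω - m1 (W0 ω)) := by
          rcases hAbin ω with h | h <;> simp [hg₁, h]
        rw [hg, hk]
        field_simp
        ring
      _ = _ := by
        rw [integral_add (by fun_prop) (hRi.const_mul _),
          integral_sub (by fun_prop) (hI₂.const_mul r), integral_sub hdi hI₁,
          integral_const_mul, integral_const_mul, hz₁, hz₂]
        ring
  have hbound := norm_integral_le_of_norm_le_const hRb
  rw [probReal_univ, mul_one, Real.norm_eq_abs] at hbound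
  rw [hFr, abs_mul, abs_of_nonneg (sq_nonneg r), mul_comm]
  exact mul_le_mul_of_nonneg_right hbound (sq_nonneg r)
end

section
/- (Neyman orthogonality of the generalized difference-in-differences moment function.) Let π be a version of P(A=1 | W₀) and π₀ a version of P(A=1 | W₋₁), each bounded above by 1−ε almost surely for some ε ∈ (0,1); let μ₁ be a bounded measurable version of E[Y₁ | W₀, A=0] and μ₀ a bounded measurable version of E[Y₀ | W₋₁, A=0]; set τ^gDiD = E[Y₁ | A=1] − E[μ₁(W₀) | A=1] − E[Y₀ | A=1] + E[μ₀(W₋₁) | A=1]. Let π̃ : 𝒲₀ → [0,1−ε], π̃₀ : 𝒲₋₁ → [0,1−ε], and bounded measurable μ̃₁ : 𝒲₀ → ℝ, μ̃₀ : 𝒲₋₁ → ℝ be alternative nuisance functions. For |r| < ε/2 define the linearly perturbed nuisances π_r = π + r(π̃−π), π₀,r = π₀ + r(π̃₀−π₀), μ₁,r = μ₁ + r(μ̃₁−μ₁), μ₀,r = μ₀ + r(μ̃₀−μ₀), and F(r) = E[ A·Y₁ − ((1−A)π_r(W₀)Y₁ + (A−π_r(W₀))μ₁,r(W₀))/(1−π_r(W₀))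 − A·Y₀ + ((1−A)π₀,r(W₋₁)Y₀ + (A−π₀,r(W₋₁))μ₀,r(W₋₁))/(1−π₀,r(W₋₁)) ] − P(A=1)·τ^gDiD. Then F(0) = 0 and F is differentiable at r = 0 with F′(0) = 0. -/
open MeasureTheory

/-- A function of `W` is orthogonal to any `Z` whose integral over every event `W ∈ S`
vanishes. -/
theorem integral_comp_mul_eq_zero {Ω 𝒲 : Type*} [MeasurableSpace Ω] [MeasurableSpace 𝒲]
    {μ : Measure Ω} [IsProbabilityMeasure μ] {W : Ω → 𝒲} (hW : Measurable W)
    {Z : Ω → ℝ} (hZ : Integrable Z μ) {g : 𝒲 → ℝ} (hg : Measurable g)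
    (hgZ : Integrable (fun ω => g (W ω) * Z ω) μ)
    (h0 : ∀ S : Set 𝒲, MeasurableSet S → ∫ ω in W ⁻¹' S, Z ω ∂μ = 0) :
    ∫ ω, g (W ω) * Z ω ∂μ = 0 := by
  have hm : MeasurableSpace.comap W inferInstance ≤ ‹MeasurableSpace Ω› := hW.comap_le
  have hzero : (0 : Ω → ℝ) =ᵐ[μ] μ[Z | MeasurableSpace.comap W inferInstance] := by
    refine ae_eq_condExp_of_forall_setIntegral_eq hm hZ
      (fun _ _ _ => (integrable_zero _ _ _).integrableOn) ?_
      stronglyMeasurable_zero.aestronglyMeasurable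
    rintro _ ⟨S, hS, rfl⟩ -
    simp [h0 S hS]
  have hgm : StronglyMeasurable[MeasurableSpace.comap W inferInstance] (fun ω => g (W ω)) :=
    (hg.comp (comap_measurable W)).stronglyMeasurable
  have hmul := condExp_mul_of_stronglyMeasurable_left hgm hgZ hZ
  calc ∫ ω, g (W ω) * Z ω ∂μ
      = ∫ ω, (μ[(fun ω => g (W ω)) * Z | MeasurableSpace.comap W inferInstance]) ω ∂μ :=
        (integral_condExp hm).symm
    _ = ∫ _, (0 : ℝ) ∂μ := by
        refine integral_congr_ae ?_
        filter_upwards [hmul, hzero] with ω h1 h2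
        rw [h1, Pi.mul_apply, ← h2]
        simp
    _ = 0 := integral_zero _ _

/-- The integrand of the adjustment term of one period, with propensity score `p` and outcome
regression `m` perturbed by `r` in the directions `pt - p` and `mt - m`. -/
noncomputable def perturbedAdjustment {Ω 𝒲 : Type*} (A Y : Ω → ℝ) (W : Ω → 𝒲)
    (p pt m mt : 𝒲 → ℝ) (r : ℝ) (ω : Ω) : ℝ :=
  ((1 - A ω) * (p (W ω) + r * (pt (W ω) - p (W ω))) * Y ω
      + (A ω - (p (W ω) + r * (pt (W ω) - p (W ω))))
        * (m (W ω) + r * (mt (W ω) - m (W ω))))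
    / (1 - (p (W ω) + r * (pt (W ω) - p (W ω))))

theorem integral_mul_eq_setIntegral_of_binary {Ω : Type*} [MeasurableSpace Ω] {μ : Measure Ω}
    {A : Ω → ℝ} (hA : Measurable A) (hAbin : ∀ ω, A ω = 0 ∨ A ω = 1) (Z : Ω → ℝ) :
    ∫ ω, A ω * Z ω ∂μ = ∫ ω in {ω | A ω = 1}, Z ω ∂μ := by
  have h1 : MeasurableSet {ω | A ω = 1} := hA (measurableSet_singleton (1 : ℝ))
  rw [← integral_indicator h1]
  congr 1
  ext ω
  rcases hAbin ω with h | h <;> simp [Set.indicator, h]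

theorem setIntegral_one_sub_mul_of_binary {Ω : Type*} [MeasurableSpace Ω] {μ : Measure Ω}
    {A : Ω → ℝ} (hA : Measurable A) (hAbin : ∀ ω, A ω = 0 ∨ A ω = 1) (Z : Ω → ℝ) {T : Set Ω}
    (hT : MeasurableSet T) :
    ∫ ω in T, (1 - A ω) * Z ω ∂μ = ∫ ω in {ω | A ω = 0} ∩ T, Z ω ∂μ := by
  have h0 : MeasurableSet {ω | A ω = 0} := hA (measurableSet_singleton (0 : ℝ))
  rw [← integral_indicator hT, ← integral_indicator (h0.inter hT)]
  congr 1
  ext ω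
  by_cases hω : ω ∈ T <;> rcases hAbin ω with h | h <;> simp [Set.indicator, h, hω]

/-- Along linear perturbations of both nuisance functions, the expected adjustment term differs
from `E[A m(W)]` by a term of second order. -/
theorem exists_abs_integral_perturbedAdjustment_sub_le {Ω 𝒲 : Type*} [MeasurableSpace Ω]
    [MeasurableSpace 𝒲] {μ : Measure Ω} [IsProbabilityMeasure μ] {A Y : Ω → ℝ} {W : Ω → 𝒲}
    (hA : Measurable A) (hAbin : ∀ ω, A ω = 0 ∨ A ω = 1) (hW : Measurable W)
    (hY : Integrable Y μ) {ε : ℝ} (hε : 0 < ε)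
    {p : 𝒲 → ℝ} (hp : IsPropensityVersion μ A W p) (hpε : ∀ᵐ ω ∂μ, p (W ω) ≤ 1 - ε)
    {m : 𝒲 → ℝ} (hm : IsCondexpVersion μ Y W {ω | A ω = 0} m)
    {C : ℝ} (hmC : ∀ w, |m w| ≤ C)
    {pt : 𝒲 → ℝ} (hpt : Measurable pt) (hptmem : ∀ w, pt w ∈ Set.Icc (0 : ℝ) (1 - ε))
    {mt : 𝒲 → ℝ} (hmt : Measurable mt) {C' : ℝ} (hmtC : ∀ w, |mt w| ≤ C') :
    ∃ K : ℝ, ∀ r : ℝ, |r| < ε / 2 →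
      Integrable (perturbedAdjustment A Y W p pt m mt r) μ ∧
      |∫ ω, perturbedAdjustment A Y W p pt m mt r ω ∂μ - ∫ ω, A ω * m (W ω) ∂μ| ≤ K * r ^ 2 := by
  obtain ⟨hpm, hp01, hpS⟩ := hp
  obtain ⟨hmm, hmi, hmS⟩ := hm
  refine ⟨(C + C') * (2 / ε), fun r hr => ?_⟩
  have hA1 : ∀ ω, |A ω| ≤ 1 := fun ω => by rcases hAbin ω with h | h <;> simp [h]
  have hA1' : ∀ ω, |1 - A ω| ≤ 1 := fun ω => by rcases hAbin ω with h | h <;> simp [h]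
  have hAi : Integrable A μ :=
    .of_bound hA.aestronglyMeasurable 1 (.of_forall hA1)
  have hpi : Integrable (fun ω => p (W ω)) μ :=
    .of_bound (hpm.comp hW).aestronglyMeasurable 1
      (.of_forall fun ω => abs_le.2 ⟨by linarith [(hp01 (W ω)).1], (hp01 (W ω)).2⟩)
  set pr : 𝒲 → ℝ := fun w => p w + r * (pt w - p w) with hpr
  have hprm : Measurable pr := hpm.add ((hpt.sub hpm).const_mul r)
  have hδ : ∀ w, |pt w - p w| ≤ 1 := fun w => by
    have h1 := hp01 w
    have h2 := hptmem w
    exact abs_le.2 ⟨by linarith [h1.2, h2.1], by linarith [h1.1, h2.2]⟩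
  have hη : ∀ w, |mt w - m w| ≤ C + C' := fun w => by
    linarith [abs_sub (mt w) (m w), hmC w, hmtC w]
  have hden : ∀ᵐ ω ∂μ, ε / 2 ≤ 1 - pr (W ω) := by
    filter_upwards [hpε] with ω h
    have h1 : |r * (pt (W ω) - p (W ω))| ≤ ε / 2 := by
      rw [abs_mul]
      nlinarith [abs_nonneg r, hδ (W ω), abs_nonneg (pt (W ω) - p (W ω))]
    have h2 := (abs_le.1 h1).2
    simp only [hpr]
    linarith
  have hinv : ∀ᵐ ω ∂μ, |(1 - pr (W ω))⁻¹| ≤ 2 / ε := by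
    filter_upwards [hden] with ω h
    rw [abs_inv, abs_of_pos (by linarith), show 2 / ε = (ε / 2)⁻¹ by field_simp]
    exact inv_anti₀ (by linarith) h
  set q : 𝒲 → ℝ := fun w => pr w * (1 - pr w)⁻¹ with hq
  have hqm : Measurable q := hprm.mul (measurable_const.sub hprm).inv
  have hqb : ∀ᵐ ω ∂μ, |q (W ω)| ≤ 1 + 2 / ε := by
    filter_upwards [hden, hinv] with ω h h'
    have h0 : 1 - pr (W ω) ≠ 0 := by linarith
    have : q (W ω) = (1 - pr (W ω))⁻¹ - 1 := by
      simp only [hq]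
      field_simp
      ring
    rw [this]
    linarith [abs_sub ((1 - pr (W ω))⁻¹) 1, abs_one (α := ℝ)]
  have hRi : Integrable (fun ω => (1 - A ω) * (Y ω - m (W ω))) μ :=
    (hY.sub hmi).bdd_mul (c := 1) (measurable_const.sub hA).aestronglyMeasurable
      (.of_forall hA1')
  have hqRi : Integrable (fun ω => q (W ω) * ((1 - A ω) * (Y ω - m (W ω)))) μ :=
    hRi.bdd_mul (hqm.comp hW).aestronglyMeasurable hqb
  have hηi : Integrable (fun ω => mt (W ω) - m (W ω)) μ :=
    .of_bound ((hmt.sub hmm).comp hW).aestronglyMeasurable (C + C') (.of_forall fun ω => hη _)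
  have hAm : Integrable (fun ω => A ω * m (W ω)) μ :=
    hmi.bdd_mul hA.aestronglyMeasurable (.of_forall hA1)
  set g : 𝒲 → ℝ := fun w => (1 - pr w)⁻¹ * (mt w - m w) with hg
  have hgm : Measurable g := (measurable_const.sub hprm).inv.mul (hmt.sub hmm)
  have hgi : Integrable (fun ω => g (W ω)) μ :=
    hηi.bdd_mul (((measurable_const.sub hprm).inv).comp hW).aestronglyMeasurable hinv
  have hAp1 : ∀ ω, |A ω - p (W ω)| ≤ 1 := fun ω => by
    have := hp01 (W ω)
    rcases hAbin ω with h | h <;> rw [h] <;>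
      exact abs_le.2 ⟨by linarith [this.1, this.2], by linarith [this.1, this.2]⟩
  have hgAi : Integrable (fun ω => g (W ω) * (A ω - p (W ω))) μ := by
    have := hgi.bdd_mul (hA.sub (hpm.comp hW)).aestronglyMeasurable (.of_forall hAp1)
    exact this.congr (.of_forall fun ω => mul_comm _ _)
  have hgδi : Integrable (fun ω => (pt (W ω) - p (W ω)) * g (W ω)) μ :=
    hgi.bdd_mul ((hpt.sub hpm).comp hW).aestronglyMeasurable (.of_forall fun ω => hδ _)
  have horthR : ∫ ω, q (W ω) * ((1 - A ω) * (Y ω - m (W ω))) ∂μ = 0 := by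
    refine integral_comp_mul_eq_zero hW hRi hqm hqRi fun S hS => ?_
    rw [setIntegral_one_sub_mul_of_binary hA hAbin _ (hW hS),
      integral_sub hY.integrableOn hmi.integrableOn, hmS S hS, sub_self]
  have horthA : ∫ ω, g (W ω) * (A ω - p (W ω)) ∂μ = 0 := by
    refine integral_comp_mul_eq_zero (Z := fun ω => A ω - p (W ω)) hW (hAi.sub hpi) hgm hgAi
      fun S hS => ?_
    rw [integral_sub hAi.integrableOn hpi.integrableOn, hpS S hS, sub_self]
  have hdecomp : perturbedAdjustment A Y W p pt m mt r =ᵐ[μ] fun ω =>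
      (q (W ω) * ((1 - A ω) * (Y ω - m (W ω))) + A ω * m (W ω))
        + (r * (g (W ω) * (A ω - p (W ω))) - r ^ 2 * ((pt (W ω) - p (W ω)) * g (W ω))) := by
    filter_upwards [hden] with ω h
    have h0 : 1 - pr (W ω) ≠ 0 := by linarith
    have hp' : p (W ω) + r * (pt (W ω) - p (W ω)) = pr (W ω) := rfl
    have hrδ : r ^ 2 * ((pt (W ω) - p (W ω)) * g (W ω))
        = r * (pr (W ω) - p (W ω)) * g (W ω) := by
      rw [← hp']
      ring
    rw [perturbedAdjustment, hp', hrδ]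
    simp only [hq, hg]
    rcases hAbin ω with hz | hz <;> rw [hz] <;> field_simp <;> ring
  have hi1 : Integrable
      (fun ω => q (W ω) * ((1 - A ω) * (Y ω - m (W ω))) + A ω * m (W ω)) μ := hqRi.add hAm
  have hi2 : Integrable (fun ω => r * (g (W ω) * (A ω - p (W ω)))
      - r ^ 2 * ((pt (W ω) - p (W ω)) * g (W ω))) μ :=
    (hgAi.const_mul r).sub (hgδi.const_mul (r ^ 2))
  refine ⟨(hi1.add hi2).congr hdecomp.symm, ?_⟩
  have hval : ∫ ω, perturbedAdjustment A Y W p pt m mt r ω ∂μ - ∫ ω, A ω * m (W ω) ∂μ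
      = -(r ^ 2 * ∫ ω, (pt (W ω) - p (W ω)) * g (W ω) ∂μ) := by
    rw [integral_congr_ae hdecomp, integral_add hi1 hi2, integral_add hqRi hAm,
      integral_sub (hgAi.const_mul r) (hgδi.const_mul (r ^ 2)), integral_const_mul,
      integral_const_mul, horthR, horthA]
    ring
  have hbound : ‖∫ ω, (pt (W ω) - p (W ω)) * g (W ω) ∂μ‖ ≤ (C + C') * (2 / ε) := by
    refine (norm_integral_le_of_norm_le_const (C := (C + C') * (2 / ε)) ?_).trans_eq (by simp)
    filter_upwards [hinv] with ω h
    simp only [hg, Real.norm_eq_abs, abs_mul]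
    have h2 : |(1 - pr (W ω))⁻¹| * |mt (W ω) - m (W ω)| ≤ (C + C') * (2 / ε) := by
      rw [mul_comm]
      exact mul_le_mul (hη _) h (abs_nonneg _) ((abs_nonneg _).trans (hη (W ω)))
    exact (mul_le_of_le_one_left (by positivity) (hδ _)).trans h2
  rw [hval, abs_neg, abs_mul, abs_of_nonneg (sq_nonneg r), mul_comm]
  exact mul_le_mul_of_nonneg_right hbound (sq_nonneg r)

/-- A function that is quadratically small near `0` vanishes there together with its
derivative. -/
theorem eq_zero_and_hasDerivAt_zero_of_abs_le_sq {F : ℝ → ℝ} {K δ : ℝ} (hδ : 0 < δ)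
    (h : ∀ r : ℝ, |r| < δ → |F r| ≤ K * r ^ 2) : F 0 = 0 ∧ HasDerivAt F 0 0 := by
  have h0 : F 0 = 0 := by simpa using h 0 (by simpa using hδ)
  refine ⟨h0, ?_⟩
  have hO : F =O[nhds 0] fun r : ℝ => r ^ 2 := by
    refine Asymptotics.IsBigO.of_bound K ?_
    filter_upwards [Metric.ball_mem_nhds (0 : ℝ) hδ] with r hr
    simpa using h r (by simpa using hr)
  rw [hasDerivAt_iff_isLittleO]
  simpa [h0] using hO.trans_isLittleO (Asymptotics.isLittleO_pow_id one_lt_two)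

/-- Neyman orthogonality of the generalized difference-in-differences moment function:
with all four nuisance functions linearly perturbed, the map `F` satisfies
`F(0) = 0` and `F′(0) = 0`. -/
theorem neyman_orthogonality_gdid
    {Ω 𝒲₀ 𝒲' : Type*} [MeasurableSpace Ω] [MeasurableSpace 𝒲₀] [MeasurableSpace 𝒲']
    (μ : Measure Ω) [IsProbabilityMeasure μ]
    (A Y1 Y0 : Ω → ℝ) (W0 : Ω → 𝒲₀) (Wm1 : Ω → 𝒲')
    (hA : Measurable A) (hAbin : ∀ ω, A ω = 0 ∨ A ω = 1)
    (hW0 : Measurable W0) (hWm1 : Measurable Wm1)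
    (hY1 : Integrable Y1 μ) (hY0 : Integrable Y0 μ)
    (hpos : 0 < μ {ω | A ω = 1}) (hlt : μ {ω | A ω = 1} < 1)
    (ε : ℝ) (hε : 0 < ε) (hε1 : ε < 1)
    (π : 𝒲₀ → ℝ) (hπ : IsPropensityVersion μ A W0 π)
    (hπε : ∀ᵐ ω ∂μ, π (W0 ω) ≤ 1 - ε)
    (π0 : 𝒲' → ℝ) (hπ0 : IsPropensityVersion μ A Wm1 π0)
    (hπ0ε : ∀ᵐ ω ∂μ, π0 (Wm1 ω) ≤ 1 - ε)
    (m1 : 𝒲₀ → ℝ) (hm1 : IsCondexpVersion μ Y1 W0 {ω | A ω = 0} m1)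
    (C₁ : ℝ) (hm1bd : ∀ w, |m1 w| ≤ C₁)
    (m0 : 𝒲' → ℝ) (hm0 : IsCondexpVersion μ Y0 Wm1 {ω | A ω = 0} m0)
    (C₀ : ℝ) (hm0bd : ∀ w, |m0 w| ≤ C₀)
    (πt : 𝒲₀ → ℝ) (hπt : Measurable πt)
    (hπtmem : ∀ w, πt w ∈ Set.Icc (0 : ℝ) (1 - ε))
    (π0t : 𝒲' → ℝ) (hπ0t : Measurable π0t)
    (hπ0tmem : ∀ w, π0t w ∈ Set.Icc (0 : ℝ) (1 - ε))
    (m1t : 𝒲₀ → ℝ) (hm1t : Measurable m1t) (C₁' : ℝ) (hm1tbd : ∀ w, |m1t w| ≤ C₁')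
    (m0t : 𝒲' → ℝ) (hm0t : Measurable m0t) (C₀' : ℝ) (hm0tbd : ∀ w, |m0t w| ≤ C₀')
    (τ : ℝ)
    (hτ : τ = cE μ Y1 {ω | A ω = 1} - cE μ (fun ω => m1 (W0 ω)) {ω | A ω = 1}
            - cE μ Y0 {ω | A ω = 1} + cE μ (fun ω => m0 (Wm1 ω)) {ω | A ω = 1})
    (F : ℝ → ℝ)
    (hF : ∀ r : ℝ, |r| < ε / 2 →
      F r = (∫ ω, (A ω * Y1 ω
          - ((1 - A ω) * (π (W0 ω) + r * (πt (W0 ω) - π (W0 ω))) * Y1 ω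
              + (A ω - (π (W0 ω) + r * (πt (W0 ω) - π (W0 ω))))
                * (m1 (W0 ω) + r * (m1t (W0 ω) - m1 (W0 ω))))
            / (1 - (π (W0 ω) + r * (πt (W0 ω) - π (W0 ω))))
          - A ω * Y0 ω
          + ((1 - A ω) * (π0 (Wm1 ω) + r * (π0t (Wm1 ω) - π0 (Wm1 ω))) * Y0 ω
              + (A ω - (π0 (Wm1 ω) + r * (π0t (Wm1 ω) - π0 (Wm1 ω))))
                * (m0 (Wm1 ω) + r * (m0t (Wm1 ω) - m0 (Wm1 ω))))
            / (1 - (π0 (Wm1 ω) + r * (π0t (Wm1 ω) - π0 (Wm1 ω))))) ∂μ)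
        - (μ {ω | A ω = 1}).toReal * τ) :
    F 0 = 0 ∧ HasDerivAt F 0 0 := by
  obtain ⟨K₁, hK₁⟩ := exists_abs_integral_perturbedAdjustment_sub_le hA hAbin hW0 hY1 hε hπ hπε
    hm1 hm1bd hπt hπtmem hm1t hm1tbd
  obtain ⟨K₀, hK₀⟩ := exists_abs_integral_perturbedAdjustment_sub_le hA hAbin hWm1 hY0 hε hπ0
    hπ0ε hm0 hm0bd hπ0t hπ0tmem hm0t hm0tbd
  refine eq_zero_and_hasDerivAt_zero_of_abs_le_sq (K := K₁ + K₀) (half_pos hε) fun r hr => ?_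
  obtain ⟨hi1, hb1⟩ := hK₁ r hr
  obtain ⟨hi0, hb0⟩ := hK₀ r hr
  have hA1 : ∀ᵐ ω ∂μ, ‖A ω‖ ≤ 1 :=
    .of_forall fun ω => by rcases hAbin ω with h | h <;> simp [h]
  have hAY1 : Integrable (fun ω => A ω * Y1 ω) μ := hY1.bdd_mul hA.aestronglyMeasurable hA1
  have hAY0 : Integrable (fun ω => A ω * Y0 ω) μ := hY0.bdd_mul hA.aestronglyMeasurable hA1
  have hP : (μ {ω | A ω = 1}).toReal ≠ 0 :=
    (ENNReal.toReal_pos hpos.ne' (measure_ne_top _ _)).ne'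
  have hτP : (μ {ω | A ω = 1}).toReal * τ = ∫ ω, A ω * Y1 ω ∂μ - ∫ ω, A ω * m1 (W0 ω) ∂μ
      - ∫ ω, A ω * Y0 ω ∂μ + ∫ ω, A ω * m0 (Wm1 ω) ∂μ := by
    simp only [integral_mul_eq_setIntegral_of_binary hA hAbin, hτ, cE]
    field_simp
  have hFr : F r = ∫ ω, (A ω * Y1 ω - perturbedAdjustment A Y1 W0 π πt m1 m1t r ω - A ω * Y0 ω
      + perturbedAdjustment A Y0 Wm1 π0 π0t m0 m0t r ω) ∂μ - (μ {ω | A ω = 1}).toReal * τ :=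
    hF r hr
  have hd1 : Integrable
      (fun ω => A ω * Y1 ω - perturbedAdjustment A Y1 W0 π πt m1 m1t r ω) μ := hAY1.sub hi1
  have hd2 : Integrable (fun ω => A ω * Y1 ω - perturbedAdjustment A Y1 W0 π πt m1 m1t r ω
      - A ω * Y0 ω) μ := hd1.sub hAY0
  rw [integral_add hd2 hi0, integral_sub hd1 hAY0,
    integral_sub hAY1 hi1, hτP] at hFr
  rw [abs_le] at hb1 hb0 ⊢
  constructor <;> linarith [hb1.1, hb1.2, hb0.1, hb0.2]
end
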